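/- arXiv:2604.10301 — 9 statements merged into one kernel-verified Lean document; each statement's English description precedes it below -/
import Mathlib

section
/- Let f be in the class C(φ). Then the second Hankel determinant satisfies |a₂a₄ − a₃²| ≤ 1/36, where aₙ denotes the n-th Taylor coefficient of f at 0. -/
open Metric

open Filter Topology ComplexConjugate

/-- `F z = A + B z + C z² + O(z³)` as `z → 0`, `z ≠ 0`, with a convergent remainder quotient. -/
def HasQuadraticExpansion (F : ℂ → ℂ) (A B C : ℂ) : Prop :=
  ∃ (R : ℂ → ℂ) (L : ℂ), Tendsto R (𝓝[≠] 0) (𝓝 L) ∧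
    ∀ᶠ z in 𝓝[≠] (0 : ℂ), F z = A + B * z + C * z ^ 2 + z ^ 3 * R z

lemma tendsto_id_punctured_nhds : Tendsto (fun z : ℂ => z) (𝓝[≠] 0) (𝓝 0) :=
  tendsto_id.mono_left nhdsWithin_le_nhds

lemma eq_zero_of_add_mul_eventually_eq_zero {A L : ℂ} {R : ℂ → ℂ}
    (hR : Tendsto R (𝓝[≠] 0) (𝓝 L)) (h : ∀ᶠ z in 𝓝[≠] (0 : ℂ), A + z * R z = 0) :
    A = 0 ∧ ∀ᶠ z in 𝓝[≠] (0 : ℂ), R z = 0 := by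
  have ht : Tendsto (fun z => A + z * R z) (𝓝[≠] 0) (𝓝 (A + 0 * L)) :=
    tendsto_const_nhds.add (tendsto_id_punctured_nhds.mul hR)
  have hA : A = 0 := by
    simpa using tendsto_nhds_unique ht (tendsto_const_nhds.congr' (h.mono fun z hz => hz.symm))
  refine ⟨hA, ?_⟩
  filter_upwards [h, self_mem_nhdsWithin] with z hz hz0
  rw [hA, zero_add] at hz
  exact (mul_eq_zero.mp hz).resolve_left hz0

namespace HasQuadraticExpansion

variable {F G : ℂ → ℂ} {A B C A' B' C' : ℂ}

lemma const (c : ℂ) : HasQuadraticExpansion (fun _ => c) c 0 0 :=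
  ⟨fun _ => 0, 0, tendsto_const_nhds, by simp⟩

lemma id : HasQuadraticExpansion (fun z => z) 0 1 0 :=
  ⟨fun _ => 0, 0, tendsto_const_nhds, by simp⟩

lemma add (hF : HasQuadraticExpansion F A B C) (hG : HasQuadraticExpansion G A' B' C') :
    HasQuadraticExpansion (fun z => F z + G z) (A + A') (B + B') (C + C') := by
  obtain ⟨R, L, hR, hF⟩ := hF
  obtain ⟨S, M, hS, hG⟩ := hG
  refine ⟨fun z => R z + S z, L + M, hR.add hS, ?_⟩
  filter_upwards [hF, hG] with z h1 h2
  rw [h1, h2]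
  ring

lemma mul (hF : HasQuadraticExpansion F A B C) (hG : HasQuadraticExpansion G A' B' C') :
    HasQuadraticExpansion (fun z => F z * G z) (A * A') (A * B' + B * A')
      (A * C' + B * B' + C * A') := by
  obtain ⟨R, L, hR, hF⟩ := hF
  obtain ⟨S, M, hS, hG⟩ := hG
  have hz := tendsto_id_punctured_nhds
  refine ⟨fun z => B * C' + C * B' + z * (C * C') + (A + B * z + C * z ^ 2) * S z
      + R z * (A' + B' * z + C' * z ^ 2 + z ^ 3 * S z), _,
    ((tendsto_const_nhds.add (hz.mul_const _)).add
      (((tendsto_const_nhds.add (hz.const_mul _)).add ((hz.pow 2).const_mul _)).mul hS)).add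
      (hR.mul (((tendsto_const_nhds.add (hz.const_mul _)).add
        ((hz.pow 2).const_mul _)).add ((hz.pow 3).mul hS))), ?_⟩
  filter_upwards [hF, hG] with z h1 h2
  rw [h1, h2]
  ring

lemma unique (hF : HasQuadraticExpansion F A B C) (hG : HasQuadraticExpansion G A' B' C')
    (h : ∀ᶠ z in 𝓝[≠] (0 : ℂ), F z = G z) : A = A' ∧ B = B' ∧ C = C' := by
  obtain ⟨R, L, hR, hF⟩ := hF
  obtain ⟨S, M, hS, hG⟩ := hG
  have hz := tendsto_id_punctured_nhds
  have h2 := hz.mul (hR.sub hS)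
  have h1 := hz.mul (h2.const_add (C - C'))
  obtain ⟨hA, e1⟩ := eq_zero_of_add_mul_eventually_eq_zero (A := A - A')
    (h1.const_add (B - B')) (by
      filter_upwards [hF, hG, h] with z k1 k2 k3
      linear_combination k3 - k1 + k2)
  obtain ⟨hB, e2⟩ := eq_zero_of_add_mul_eventually_eq_zero (h2.const_add (C - C')) e1
  obtain ⟨hC, -⟩ := eq_zero_of_add_mul_eventually_eq_zero (hR.sub hS) e2
  exact ⟨sub_eq_zero.mp hA, sub_eq_zero.mp hB, sub_eq_zero.mp hC⟩

lemma _root_.HasFPowerSeriesAt.hasQuadraticExpansion {p : FormalMultilinearSeries ℂ ℂ ℂ}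
    (hp : HasFPowerSeriesAt F p 0) :
    HasQuadraticExpansion F (p.coeff 0) (p.coeff 1) (p.coeff 2) := by
  have hp1 := hp.has_fpower_series_dslope_fslope
  have hp2 := hp1.has_fpower_series_dslope_fslope
  have hp3 := hp2.has_fpower_series_dslope_fslope
  refine ⟨_, _, hp3.continuousAt.tendsto.mono_left nhdsWithin_le_nhds, Eventually.of_forall ?_⟩
  intro z
  have c0 : F 0 = p.coeff 0 := (hp.coeff_zero _).symm
  have c1 : dslope F 0 0 = p.coeff 1 := by
    simpa using (hp1.coeff_zero 1).symm
  have c2 : dslope (dslope F 0) 0 0 = p.coeff 2 := by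
    simpa using (hp2.coeff_zero 1).symm
  have e0 := sub_smul_dslope F 0 z
  have e1 := sub_smul_dslope (dslope F 0) 0 z
  have e2 := sub_smul_dslope (dslope (dslope F 0) 0) 0 z
  simp only [sub_zero, smul_eq_mul] at e0 e1 e2
  rw [← c0, ← c1, ← c2]
  linear_combination -e0 - z * e1 - z ^ 2 * e2

lemma of_analyticAt (hF : AnalyticAt ℂ F 0) :
    HasQuadraticExpansion F (F 0) (deriv F 0) (iteratedDeriv 2 F 0 / 2) := by
  simpa [FormalMultilinearSeries.coeff_ofScalars] using
    hF.hasFPowerSeriesAt.hasQuadraticExpansion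

end HasQuadraticExpansion

lemma Complex.norm_sub_le_norm_one_sub_conj_mul {a b : ℂ} (ha : ‖a‖ ≤ 1) (hb : ‖b‖ ≤ 1) :
    ‖b - a‖ ≤ ‖1 - conj a * b‖ := by
  have key : ‖1 - conj a * b‖ ^ 2 - ‖b - a‖ ^ 2 = (1 - ‖a‖ ^ 2) * (1 - ‖b‖ ^ 2) := by
    simp only [← Complex.normSq_eq_norm_sq, Complex.normSq_apply]
    simp
    ring
  have h1 : 0 ≤ 1 - ‖a‖ ^ 2 := by nlinarith [norm_nonneg a]
  have h2 : 0 ≤ 1 - ‖b‖ ^ 2 := by nlinarith [norm_nonneg b]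
  exact le_of_sq_le_sq (by nlinarith [mul_nonneg h1 h2]) (norm_nonneg _)

/-- One step of the Schur algorithm. -/
lemma exists_schur_step {g : ℂ → ℂ} (hg : DifferentiableOn ℂ g (ball 0 1))
    (hg1 : ∀ z ∈ ball (0 : ℂ) 1, ‖g z‖ ≤ 1) :
    ∃ h : ℂ → ℂ, DifferentiableOn ℂ h (ball 0 1) ∧ (∀ z ∈ ball (0 : ℂ) 1, ‖h z‖ ≤ 1) ∧
      ∀ z ∈ ball (0 : ℂ) 1, g z = g 0 + z * h z * (1 - conj (g 0) * g z) := by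
  have h0 : (0 : ℂ) ∈ ball (0 : ℂ) 1 := mem_ball_self one_pos
  rcases (hg1 0 h0).lt_or_eq with hlt | heq
  · have hne : ∀ z ∈ ball (0 : ℂ) 1, 1 - conj (g 0) * g z ≠ 0 := by
      intro z hz hzero
      have : ‖conj (g 0) * g z‖ = 1 := by rw [← sub_eq_zero.mp hzero, norm_one]
      rw [norm_mul, RCLike.norm_conj] at this
      nlinarith [hg1 z hz, norm_nonneg (g z), norm_nonneg (g 0)]
    set F : ℂ → ℂ := fun z => (g z - g 0) / (1 - conj (g 0) * g z) with hFdef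
    have hF : DifferentiableOn ℂ F (ball 0 1) :=
      (hg.sub_const _).div ((differentiableOn_const _).sub (hg.const_mul _)) hne
    have hF0 : F 0 = 0 := by simp [hFdef]
    have hmaps : Set.MapsTo F (ball 0 1) (closedBall (F 0) 1) := by
      intro z hz
      rw [hF0, mem_closedBall_zero_iff, hFdef, norm_div]
      exact div_le_one_of_le₀
        (Complex.norm_sub_le_norm_one_sub_conj_mul (hg1 0 h0) (hg1 z hz)) (norm_nonneg _)
    refine ⟨dslope F 0, (Complex.differentiableOn_dslope (isOpen_ball.mem_nhds h0)).2 hF,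
      fun z hz => ?_, fun z hz => ?_⟩
    · simpa using Complex.norm_dslope_le_div_of_mapsTo_ball hF hmaps hz
    · have e := sub_smul_dslope F 0 z
      rw [hF0, sub_zero, sub_zero, smul_eq_mul] at e
      rw [e, hFdef, div_mul_cancel₀ _ (hne z hz)]
      ring
  · refine ⟨fun _ => 0, differentiableOn_const _, by simp, fun z hz => ?_⟩
    have := Complex.eqOn_of_isPreconnected_of_isMaxOn_norm (convex_ball 0 1).isPreconnected
      isOpen_ball hg h0 (fun w hw => by simpa [heq] using hg1 w hw) hz
    simpa using this

lemma eventually_mem_ball_punctured : ∀ᶠ z in 𝓝[≠] (0 : ℂ), z ∈ ball (0 : ℂ) 1 :=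
  mem_nhdsWithin_of_mem_nhds (ball_mem_nhds 0 one_pos)

lemma DifferentiableOn.hasQuadraticExpansion {F : ℂ → ℂ} (hF : DifferentiableOn ℂ F (ball 0 1)) :
    HasQuadraticExpansion F (F 0) (_root_.deriv F 0) (iteratedDeriv 2 F 0 / 2) :=
  .of_analyticAt (hF.analyticAt (ball_mem_nhds 0 one_pos))

/-- The expansion of `g` in terms of a Schur step `h`. -/
lemma schur_step_coeff {g h : ℂ → ℂ} {b₀ b₁ b₂ x₀ x₁ x₂ : ℂ}
    (hg : HasQuadraticExpansion g b₀ b₁ b₂) (hh : HasQuadraticExpansion h x₀ x₁ x₂)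
    (hgh : ∀ z ∈ ball (0 : ℂ) 1, g z = b₀ + z * h z * (1 - conj b₀ * g z)) :
    b₁ = x₀ * (1 - conj b₀ * b₀) ∧
      b₂ = x₁ * (1 - conj b₀ * b₀) - x₀ * conj b₀ * b₁ := by
  obtain ⟨-, h1, h2⟩ := hg.unique
    ((HasQuadraticExpansion.const b₀).add ((HasQuadraticExpansion.id.mul hh).mul
      ((HasQuadraticExpansion.const 1).add ((HasQuadraticExpansion.const (-conj b₀)).mul hg))))
    (eventually_mem_ball_punctured.mono fun z hz => by linear_combination hgh z hz)
  exact ⟨by linear_combination h1, by linear_combination h2⟩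

/-- Parametrization of the first three coefficients of a function bounded by one. -/
lemma exists_schur_parameters {g : ℂ → ℂ} (hg : DifferentiableOn ℂ g (ball 0 1))
    (hg1 : ∀ z ∈ ball (0 : ℂ) 1, ‖g z‖ ≤ 1) :
    ∃ x y : ℂ, ‖x‖ ≤ 1 ∧ ‖y‖ ≤ 1 ∧ HasQuadraticExpansion g (g 0)
      ((1 - (‖g 0‖ : ℂ) ^ 2) * x)
      ((1 - (‖g 0‖ : ℂ) ^ 2) * ((1 - (‖x‖ : ℂ) ^ 2) * y - conj (g 0) * x ^ 2)) := by
  have h0 : (0 : ℂ) ∈ ball (0 : ℂ) 1 := mem_ball_self one_pos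
  obtain ⟨h, hd, hb, hgh⟩ := exists_schur_step hg hg1
  obtain ⟨k, kd, kb, hhk⟩ := exists_schur_step hd hb
  refine ⟨h 0, k 0, hb 0 h0, kb 0 h0, ?_⟩
  obtain ⟨e1, e2⟩ :=
    schur_step_coeff hg.hasQuadraticExpansion hd.hasQuadraticExpansion hgh
  obtain ⟨e3, -⟩ :=
    schur_step_coeff hd.hasQuadraticExpansion kd.hasQuadraticExpansion hhk
  rw [Complex.conj_mul'] at e1 e2 e3
  convert hg.hasQuadraticExpansion using 1
  · rw [e1]
    ring
  · rw [e2, e1, e3]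
    ring

lemma norm_schur_functional_le {c x y : ℂ} (hc : ‖c‖ ≤ 1) (hx : ‖x‖ ≤ 1) (hy : ‖y‖ ≤ 1) :
    ‖3 * c * (1 - (‖c‖ : ℂ) ^ 2) * (1 - (‖x‖ : ℂ) ^ 2) * y
      - (1 - (‖c‖ : ℂ) ^ 2) * (2 + (‖c‖ : ℂ) ^ 2) * x ^ 2
      + c ^ 2 * (1 - (‖c‖ : ℂ) ^ 2) * x - c ^ 4 / 2‖ ≤ 2 := by
  have norm_eq : ∀ r : ℝ, 0 ≤ r → ‖(r : ℂ)‖ = r := fun r hr => by simp [abs_of_nonneg hr]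
  have hc0 := norm_nonneg c
  have hx0 := norm_nonneg x
  have n1 : ‖1 - (‖c‖ : ℂ) ^ 2‖ = 1 - ‖c‖ ^ 2 := by
    simpa only [Complex.ofReal_sub, Complex.ofReal_one, Complex.ofReal_pow] using
      norm_eq (1 - ‖c‖ ^ 2) (sub_nonneg.2 (pow_le_one₀ hc0 hc))
  have n2 : ‖1 - (‖x‖ : ℂ) ^ 2‖ = 1 - ‖x‖ ^ 2 := by
    simpa only [Complex.ofReal_sub, Complex.ofReal_one, Complex.ofReal_pow] using
      norm_eq (1 - ‖x‖ ^ 2) (sub_nonneg.2 (pow_le_one₀ hx0 hx))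
  have n3 : ‖2 + (‖c‖ : ℂ) ^ 2‖ = 2 + ‖c‖ ^ 2 := by
    have h : 2 + (‖c‖ : ℂ) ^ 2 = ((2 + ‖c‖ ^ 2 : ℝ) : ℂ) := by push_cast; ring
    rw [h, norm_eq _ (by positivity)]
  refine (norm_sub_le _ _).trans ((add_le_add_left ((norm_add_le _ _).trans
    (add_le_add_left (norm_sub_le _ _) _)) _).trans ?_)
  simp only [norm_mul, norm_pow, norm_div, n1, n2, n3, Complex.norm_ofNat]
  generalize ‖c‖ = s at *
  generalize ‖x‖ = t at *
  have hs : 0 ≤ 1 - s ^ 2 := by nlinarith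
  have ht : 0 ≤ 1 - t ^ 2 := by nlinarith
  have hyb : 3 * s * (1 - s ^ 2) * (1 - t ^ 2) * ‖y‖ ≤ 3 * s * (1 - s ^ 2) * (1 - t ^ 2) :=
    mul_le_of_le_one_right (by positivity) hy
  have hquad : 3 * s * (1 - t ^ 2) + (2 + s ^ 2) * t ^ 2 + s ^ 2 * t ≤ 2 + 2 * s ^ 2 := by
    nlinarith [mul_nonneg ht (mul_nonneg (sub_nonneg.2 hc) (by linarith : 0 ≤ 2 - s)),
      mul_nonneg (sq_nonneg s) (sub_nonneg.2 hx)]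
  nlinarith [mul_le_mul_of_nonneg_left hquad hs, pow_nonneg hc0 4]

/-- The derivatives at the origin of the sum of a power series. -/
lemma iteratedDeriv_eq_factorial_mul_coeff {f : ℂ → ℂ} {a : ℕ → ℂ} (hf : AnalyticAt ℂ f 0)
    (ha : ∀ z ∈ ball (0 : ℂ) 1, HasSum (fun n => a n * z ^ n) (f z)) (n : ℕ) :
    iteratedDeriv n f 0 = n.factorial * a n := by
  have hp : HasFPowerSeriesAt f (FormalMultilinearSeries.ofScalars ℂ a) 0 := by
    rw [hasFPowerSeriesAt_iff]
    filter_upwards [ball_mem_nhds (0 : ℂ) one_pos] with z hz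
    simpa [FormalMultilinearSeries.coeff_ofScalars, mul_comm] using ha z hz
  have := congrArg (fun p => p.coeff n)
    (hf.hasFPowerSeriesAt.eq_formalMultilinearSeries hp)
  simp only [FormalMultilinearSeries.coeff_ofScalars] at this
  have hn : (n.factorial : ℂ) ≠ 0 := by exact_mod_cast n.factorial_ne_zero
  field_simp at this
  linear_combination this

/-- **Second Hankel determinant bound for the class `C(φ)`, `φ(z) = (1 + z/2)²`.**
If `f` is analytic on the unit disk with Taylor expansion `f(z) = z + Σ_{n≥2} aₙ zⁿ`,
and there is a Schwarz function `ω` with `z f''(z) = f'(z) (φ(ω(z)) − 1)` on the disk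
(i.e. `f ∈ C(φ)`), then `|a₂ a₄ − a₃²| ≤ 1/36`. -/
theorem second_hankel_bound
    (f : ℂ → ℂ) (a : ℕ → ℂ) (ω : ℂ → ℂ)
    (hf : AnalyticOnNhd ℂ f (ball (0:ℂ) 1))
    (ha : ∀ z ∈ ball (0:ℂ) 1, HasSum (fun n => a n * z ^ n) (f z))
    (ha0 : a 0 = 0) (ha1 : a 1 = 1)
    (hω : AnalyticOnNhd ℂ ω (ball (0:ℂ) 1))
    (hω0 : ω 0 = 0)
    (hω1 : ∀ z ∈ ball (0:ℂ) 1, ‖ω z‖ < 1)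
    (hsub : ∀ z ∈ ball (0:ℂ) 1,
      z * deriv (deriv f) z = deriv f z * ((1 + ω z / 2) ^ 2 - 1)) :
    ‖a 2 * a 4 - a 3 ^ 2‖ ≤ 1 / 36 := by
  have h0 : (0 : ℂ) ∈ ball (0 : ℂ) 1 := mem_ball_self one_pos
  have hcoeff := iteratedDeriv_eq_factorial_mul_coeff (hf 0 h0) ha
  have d1 : deriv f 0 = 1 := by simpa [ha1] using hcoeff 1
  have d2 : deriv (deriv f) 0 = 2 * a 2 := by
    simpa [iteratedDeriv_succ', Nat.factorial] using hcoeff 2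
  have d3 : deriv (deriv (deriv f)) 0 = 6 * a 3 := by
    have := hcoeff 3
    norm_num [iteratedDeriv_succ', Nat.factorial] at this
    exact this
  have d4 : deriv (deriv (deriv (deriv f))) 0 = 24 * a 4 := by
    have := hcoeff 4
    norm_num [iteratedDeriv_succ', Nat.factorial] at this
    exact this
  have hf1 := HasQuadraticExpansion.of_analyticAt (hf.deriv 0 h0)
  have hf2 := HasQuadraticExpansion.of_analyticAt (hf.deriv.deriv 0 h0)
  simp only [iteratedDeriv_succ', iteratedDeriv_zero, d1, d2, d3, d4] at hf1 hf2
  obtain ⟨ψ, ψd, ψb, hψ⟩ := exists_schur_step hω.differentiableOn fun z hz => (hω1 z hz).le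
  obtain ⟨x, y, hx, hy, hψe⟩ := exists_schur_parameters ψd ψb
  have hc := ψb 0 h0
  obtain ⟨e1, e2, e3⟩ := hf2.unique
    (hf1.mul (hψe.add ((HasQuadraticExpansion.const (1 / 4)).mul
      (HasQuadraticExpansion.id.mul (hψe.mul hψe))))) (by
      filter_upwards [eventually_mem_ball_punctured, self_mem_nhdsWithin] with z hz hz0
      apply mul_left_cancel₀ (show z ≠ 0 from hz0)
      have hωz : ω z = z * ψ z := by simpa [hω0] using hψ z hz
      rw [hsub z hz, hωz]
      ring)
  have hbound := norm_schur_functional_le hc hx hy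
  have hcc : conj (ψ 0) * ψ 0 = (‖ψ 0‖ : ℂ) ^ 2 := Complex.conj_mul' _
  generalize ψ 0 = c at *
  have a2 : a 2 = c / 2 := by linear_combination e1 / 2
  rw [a2] at e2 e3
  generalize hsdef : (‖c‖ : ℂ) ^ 2 = s at *
  have a3 : a 3 = ((1 - s) * x + 5 / 4 * c ^ 2) / 6 := by linear_combination e2 / 6
  rw [a3] at e3
  have a4 : a 4 = ((1 - s) * ((1 - (‖x‖ : ℂ) ^ 2) * y - conj c * x ^ 2)
      + 2 * c * ((1 - s) * x) + 7 / 8 * c ^ 3) / 12 := by linear_combination e3 / 12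
  have key : a 2 * a 4 - a 3 ^ 2 = (3 * c * (1 - s) * (1 - (‖x‖ : ℂ) ^ 2) * y
      - (1 - s) * (2 + s) * x ^ 2 + c ^ 2 * (1 - s) * x - c ^ 4 / 2) / 72 := by
    rw [a2, a3, a4]
    linear_combination (-(1 - s) * x ^ 2 / 24) * hcc
  rw [key, norm_div, Complex.norm_ofNat]
  linarith
end

section
/- The bound 1/36 for the second Hankel determinant on C(φ) is sharp: the function f̃ ∈ 𝒜 determined by 1 + z f̃''(z)/f̃'(z) = φ(z²) for z ∈ 𝔻 belongs to C(φ), has Taylor coefficients a₂ = 0, a₃ = 1/6, a₄ = 0, and satisfies a₂a₄ − a₃² = −1/36. -/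
open Metric

open scoped Nat Topology

/-- The coefficients of a power series converging to `f` near `0` are the Taylor coefficients. -/
theorem coeff_eq_iteratedDeriv_div_factorial {f : ℂ → ℂ} {a : ℕ → ℂ} (hf : AnalyticAt ℂ f 0)
    (ha : ∀ᶠ z in 𝓝 (0 : ℂ), HasSum (fun n => a n * z ^ n) (f z)) (n : ℕ) :
    a n = iteratedDeriv n f 0 / n ! := by
  have h : HasFPowerSeriesAt f (FormalMultilinearSeries.ofScalars ℂ a) 0 := by
    rw [hasFPowerSeriesAt_iff]
    filter_upwards [ha] with z hz
    simpa [mul_comm] using hz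
  simpa using congrArg (fun p => p.coeff n)
    (h.eq_formalMultilinearSeries hf.hasFPowerSeriesAt)

/-- A factor `z` can be cancelled in an identity between functions continuous on the unit disk. -/
theorem eqOn_ball_of_mul_left_eq {g h : ℂ → ℂ} (hg : ContinuousOn g (ball 0 1))
    (hh : ContinuousOn h (ball 0 1)) (H : ∀ z ∈ ball (0 : ℂ) 1, z * g z = z * h z) :
    Set.EqOn g h (ball 0 1) := by
  intro z hz
  rcases eq_or_ne z 0 with rfl | hz0
  · have hn : ball (0 : ℂ) 1 ∈ 𝓝 0 := ball_mem_nhds 0 one_pos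
    have e : g =ᶠ[𝓝[≠] 0] h := by
      filter_upwards [self_mem_nhdsWithin, mem_nhdsWithin_of_mem_nhds hn] with w hw hwb
      exact mul_left_cancel₀ hw (H w hwb)
    exact ((hg.continuousAt hn).eventuallyEq_nhds_iff_eventuallyEq_nhdsNE
      (hh.continuousAt hn)).1 e |>.eq_of_nhds
  · exact mul_left_cancel₀ hz0 (H z hz)

/-- **Sharpness of the bound `1/36` for the second Hankel determinant on `C(φ)`,
`φ(z) = (1 + z/2)²`.** The function `f̃` determined by
`1 + z f̃''(z)/f̃'(z) = φ(z²)` on the unit disk belongs to `C(φ)`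
(i.e. there is a Schwarz function `ω` with `z f̃'' = f̃' (φ(ω(z)) − 1)`),
has Taylor coefficients `a₂ = 0`, `a₃ = 1/6`, `a₄ = 0`, and satisfies
`a₂ a₄ − a₃² = −1/36`. -/
theorem second_hankel_sharp
    (f : ℂ → ℂ) (a : ℕ → ℂ)
    (hf : AnalyticOnNhd ℂ f (ball (0:ℂ) 1))
    (ha : ∀ z ∈ ball (0:ℂ) 1, HasSum (fun n => a n * z ^ n) (f z))
    (ha0 : a 0 = 0) (ha1 : a 1 = 1)
    (hsub : ∀ z ∈ ball (0:ℂ) 1,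
      z * deriv (deriv f) z = deriv f z * ((1 + z ^ 2 / 2) ^ 2 - 1)) :
    (∃ ω : ℂ → ℂ, AnalyticOnNhd ℂ ω (ball (0:ℂ) 1) ∧ ω 0 = 0 ∧
        (∀ z ∈ ball (0:ℂ) 1, ‖ω z‖ < 1) ∧
        ∀ z ∈ ball (0:ℂ) 1,
          z * deriv (deriv f) z = deriv f z * ((1 + ω z / 2) ^ 2 - 1)) ∧
      a 2 = 0 ∧ a 3 = 1 / 6 ∧ a 4 = 0 ∧
      a 2 * a 4 - a 3 ^ 2 = -(1 / 36) := by
  refine ⟨⟨fun z => z ^ 2, fun z _ => by fun_prop, by simp, fun z hz => ?_, hsub⟩, ?_⟩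
  · rw [mem_ball_zero_iff] at hz
    simpa using pow_lt_one₀ (norm_nonneg z) hz two_ne_zero
  have h0 : (0 : ℂ) ∈ ball (0 : ℂ) 1 := mem_ball_self one_pos
  have coeff := coeff_eq_iteratedDeriv_div_factorial (hf 0 h0)
    (Filter.eventually_of_mem (ball_mem_nhds 0 one_pos) ha)
  have hg := hf.deriv
  have hq (z : ℂ) : HasDerivAt (fun z : ℂ => z + z ^ 3 / 4) (1 + 3 * z ^ 2 / 4) z := by
    simpa using (hasDerivAt_id' z).fun_add ((hasDerivAt_pow 3 z).div_const 4)
  have hq' (z : ℂ) : HasDerivAt (fun z : ℂ => 1 + 3 * z ^ 2 / 4) (3 * z / 2) z := by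
    refine ((((hasDerivAt_pow 2 z).const_mul 3).div_const 4).const_add 1).congr_deriv ?_
    norm_num
    ring
  have d1 : Set.EqOn (deriv (deriv f)) (fun z => deriv f z * (z + z ^ 3 / 4)) (ball 0 1) := by
    refine eqOn_ball_of_mul_left_eq hg.deriv.continuousOn
      (hg.continuousOn.mul (by fun_prop)) fun z hz => ?_
    rw [hsub z hz]
    ring
  have d2 : Set.EqOn (deriv (deriv (deriv f))) (fun z => deriv (deriv f) z * (z + z ^ 3 / 4) +
      deriv f z * (1 + 3 * z ^ 2 / 4)) (ball 0 1) := fun z hz => by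
    rw [d1.deriv isOpen_ball hz]
    exact ((hg z hz).differentiableAt.hasDerivAt.mul (hq z)).deriv
  have d3 := d2.deriv isOpen_ball h0
  have d3' := (((hg.deriv 0 h0).differentiableAt.hasDerivAt.mul (hq 0)).add
    ((hg 0 h0).differentiableAt.hasDerivAt.mul (hq' 0))).deriv
  have e0 : deriv f 0 = 1 := by
    have := coeff 1
    rw [ha1] at this
    simpa using this.symm
  have e1 : deriv (deriv f) 0 = 0 := by simpa using d1 h0
  have e2 : deriv (deriv (deriv f)) 0 = 1 := by simpa [e0] using d2 h0
  have e3 : deriv (deriv (deriv (deriv f))) 0 = 0 := by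
    refine (d3.trans d3').trans ?_
    simp [e1]
  have a2 : a 2 = 0 := by
    rw [coeff 2]
    simp [iteratedDeriv_succ, e1]
  have a3 : a 3 = 1 / 6 := by
    rw [coeff 3]
    simp [iteratedDeriv_succ, e2, Nat.factorial]
  have a4 : a 4 = 0 := by
    rw [coeff 4]
    simp [iteratedDeriv_succ, e3]
  refine ⟨a2, a3, a4, ?_⟩
  rw [a2, a3]
  norm_num
end

section
/- The bound 1/144 for the third Hankel determinant on C(φ) is sharp: the function f̃ ∈ 𝒜 determined by 1 + z f̃''(z)/f̃'(z) = φ(z³) = 1 + z³ + z⁶/4 for z ∈ 𝔻 belongs to C(φ) and satisfies |a₃(a₂a₄ − a₃²) − a₄(a₄ − a₂a₃) + a₅(a₃ − a₂²)| = 1/144. -/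
open Metric Polynomial Filter Topology

/-- Taylor coefficients of an analytic function are determined by any convergent expansion. -/
lemma iteratedDeriv_zero_of_hasSum {f : ℂ → ℂ} {a : ℕ → ℂ} (hf : AnalyticAt ℂ f 0)
    (ha : ∀ᶠ z in 𝓝 (0 : ℂ), HasSum (fun n => a n * z ^ n) (f z)) (n : ℕ) :
    a n = iteratedDeriv n f 0 / n.factorial := by
  have h1 : HasFPowerSeriesAt f (FormalMultilinearSeries.ofScalars ℂ a) 0 := by
    rw [hasFPowerSeriesAt_iff]
    filter_upwards [ha] with z hz
    simpa [FormalMultilinearSeries.coeff_ofScalars, mul_comm] using hz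
  have h2 := congrArg (fun p => p.coeff n) (h1.eq_formalMultilinearSeries hf.hasFPowerSeriesAt)
  simpa [FormalMultilinearSeries.coeff_ofScalars] using h2

/-- The polynomials `Q k` with `g⁽ᵏ⁾ = g Q k` whenever `g' = g P`. -/
noncomputable def logDerivPoly (P : ℂ[X]) : ℕ → ℂ[X]
  | 0 => 1
  | k + 1 => derivative (logDerivPoly P k) + logDerivPoly P k * P

lemma iteratedDeriv_eq_mul_logDerivPoly {g : ℂ → ℂ} {P : ℂ[X]} {U : Set ℂ} (hU : IsOpen U)
    (hg : DifferentiableOn ℂ g U) (hP : ∀ z ∈ U, deriv g z = g z * P.eval z) (k : ℕ) :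
    ∀ z ∈ U, iteratedDeriv k g z = g z * (logDerivPoly P k).eval z := by
  induction k with
  | zero => simp [logDerivPoly]
  | succ k ih =>
    intro z hz
    have hnhds : U ∈ 𝓝 z := hU.mem_nhds hz
    have heq : iteratedDeriv k g =ᶠ[𝓝 z] fun w => g w * (logDerivPoly P k).eval w :=
      eventually_of_mem hnhds ih
    have hd := ((hg.differentiableAt hnhds).hasDerivAt).mul ((logDerivPoly P k).hasDerivAt z)
    rw [iteratedDeriv_succ, heq.deriv_eq]
    refine hd.deriv.trans ?_
    rw [hP z hz, logDerivPoly, eval_add, eval_mul]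
    ring

/-- Cancelling a factor `z` in an identity between continuous functions on the unit disk. -/
lemma eqOn_ball_of_mul_left {u v : ℂ → ℂ} (hu : ContinuousAt u 0) (hv : ContinuousAt v 0)
    (h : ∀ z ∈ ball (0 : ℂ) 1, z * u z = z * v z) : ∀ z ∈ ball (0 : ℂ) 1, u z = v z := by
  have hne : ∀ z ∈ ball (0 : ℂ) 1, z ≠ 0 → u z = v z := fun z hz h0 =>
    mul_left_cancel₀ h0 (h z hz)
  intro z hz
  rcases eq_or_ne z 0 with rfl | h0
  · have hev : u =ᶠ[𝓝[≠] 0] v := by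
      filter_upwards [mem_nhdsWithin_of_mem_nhds (ball_mem_nhds (0 : ℂ) one_pos),
        self_mem_nhdsWithin] with w hw hw0 using hne w hw hw0
    exact tendsto_nhds_unique ((hu.tendsto.mono_left nhdsWithin_le_nhds).congr' hev)
      (hv.tendsto.mono_left nhdsWithin_le_nhds)
  · exact hne z hz h0

/-- **Sharpness of the bound `1/144` for the third Hankel determinant on `C(φ)`,
`φ(z) = (1 + z/2)²`.** The function `f̃` determined by
`1 + z f̃''(z)/f̃'(z) = φ(z³) = 1 + z³ + z⁶/4` on the unit disk belongs to `C(φ)`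
(i.e. there is a Schwarz function `ω` with `z f̃'' = f̃' (φ(ω(z)) − 1)`) and satisfies
`|a₃(a₂a₄ − a₃²) − a₄(a₄ − a₂a₃) + a₅(a₃ − a₂²)| = 1/144`. -/
theorem third_hankel_sharp
    (f : ℂ → ℂ) (a : ℕ → ℂ)
    (hf : AnalyticOnNhd ℂ f (ball (0:ℂ) 1))
    (ha : ∀ z ∈ ball (0:ℂ) 1, HasSum (fun n => a n * z ^ n) (f z))
    (ha0 : a 0 = 0) (ha1 : a 1 = 1)
    (hsub : ∀ z ∈ ball (0:ℂ) 1,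
      z * deriv (deriv f) z = deriv f z * ((1 + z ^ 3 / 2) ^ 2 - 1)) :
    (∃ ω : ℂ → ℂ, AnalyticOnNhd ℂ ω (ball (0:ℂ) 1) ∧ ω 0 = 0 ∧
        (∀ z ∈ ball (0:ℂ) 1, ‖ω z‖ < 1) ∧
        ∀ z ∈ ball (0:ℂ) 1,
          z * deriv (deriv f) z = deriv f z * ((1 + ω z / 2) ^ 2 - 1)) ∧
      ‖a 3 * (a 2 * a 4 - a 3 ^ 2) - a 4 * (a 4 - a 2 * a 3) + a 5 * (a 3 - a 2 ^ 2)‖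
        = 1 / 144 := by
  refine ⟨⟨fun z => z ^ 3, fun z _ => by fun_prop, by simp, fun z hz => ?_, hsub⟩, ?_⟩
  · rw [norm_pow]
    exact pow_lt_one₀ (norm_nonneg z) (by simpa using hz) three_ne_zero
  have hmem : (0 : ℂ) ∈ ball (0 : ℂ) 1 := mem_ball_self one_pos
  have hg := hf.deriv
  let P : ℂ[X] := X ^ 2 + C (1 / 4) * X ^ 5
  have hP : ∀ z ∈ ball (0 : ℂ) 1, deriv (deriv f) z = deriv f z * P.eval z := by
    refine eqOn_ball_of_mul_left (hg.deriv 0 hmem).continuousAt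
      ((hg 0 hmem).continuousAt.mul P.continuous.continuousAt) fun z hz => ?_
    rw [hsub z hz]
    simp only [P, eval_add, eval_mul, eval_pow, eval_X, eval_C]
    ring
  have hcoeff := iteratedDeriv_zero_of_hasSum (hf 0 hmem)
    (eventually_of_mem (ball_mem_nhds 0 one_pos) ha)
  have hg0 : deriv f 0 = 1 := by simpa [ha1] using (hcoeff 1).symm
  have hQ : ∀ k, a (k + 1) = (logDerivPoly P k).eval 0 / (k + 1).factorial := fun k => by
    rw [hcoeff, iteratedDeriv_succ',
      iteratedDeriv_eq_mul_logDerivPoly isOpen_ball hg.differentiableOn hP k 0 hmem, hg0, one_mul]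
  have h2 : a 2 = 0 := by simp [hQ 1, logDerivPoly, P]
  have h3 : a 3 = 0 := by simp [hQ 2, logDerivPoly, P]
  have h4 : a 4 = 1 / 12 := by
    rw [hQ 3]
    simp [logDerivPoly, P, Nat.factorial]
    norm_num
  have h5 : a 5 = 0 := by simp [hQ 4, logDerivPoly, P]
  rw [h2, h3, h4, h5]
  norm_num
end

section
/- Coefficient formulas over the Carathéodory class: let f ∈ 𝒜 with Taylor coefficients aₙ, let p be analytic on 𝔻 with p(0) = 1 and Re p(z) > 0 on 𝔻, with Taylor expansion p(z) = 1 + Σ_{n≥1} pₙ zⁿ, and suppose ω := (p − 1)/(p + 1) satisfies z f''(z) = f'(z)(φ(ω(z)) − 1) on 𝔻. Then a₂ = p₁/4, a₃ = (p₁² + 8p₂)/96, a₄ = (−p₁³ + 32p₃)/768, and a₅ = (11p₁⁴ − 48p₁²p₂ − 64p₁p₃ − 96p₂² + 768p₄)/30720. -/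
open Metric

open scoped Topology Nat PowerSeries

/-- The formal Taylor series of `g : ℂ → ℂ` at the origin. -/
noncomputable def taylorSeriesAtZero (g : ℂ → ℂ) : ℂ⟦X⟧ :=
  PowerSeries.mk fun n => iteratedDeriv n g 0 / n !

lemma coeff_taylorSeriesAtZero (g : ℂ → ℂ) (n : ℕ) :
    PowerSeries.coeff n (taylorSeriesAtZero g) = iteratedDeriv n g 0 / n ! :=
  PowerSeries.coeff_mk _ _

lemma taylorSeriesAtZero_congr {g h : ℂ → ℂ} (hgh : g =ᶠ[𝓝 0] h) :
    taylorSeriesAtZero g = taylorSeriesAtZero h := by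
  ext n
  rw [coeff_taylorSeriesAtZero, coeff_taylorSeriesAtZero, (hgh.iteratedDeriv n).eq_of_nhds]

lemma taylorSeriesAtZero_of_hasSum {g : ℂ → ℂ} {b : ℕ → ℂ}
    (hb : ∀ᶠ z in 𝓝 0, HasSum (fun n => b n * z ^ n) (g z)) :
    taylorSeriesAtZero g = PowerSeries.mk b := by
  have hser : HasFPowerSeriesAt g (FormalMultilinearSeries.ofScalars ℂ b) 0 := by
    rw [hasFPowerSeriesAt_iff]
    filter_upwards [hb] with z hz
    simpa [mul_comm] using hz
  have heq := hser.eq_formalMultilinearSeries hser.analyticAt.hasFPowerSeriesAt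
  ext n
  have hcoeff := congrArg (fun q => FormalMultilinearSeries.coeff q n) heq
  simp only [FormalMultilinearSeries.coeff_ofScalars] at hcoeff
  rw [coeff_taylorSeriesAtZero, PowerSeries.coeff_mk, hcoeff]

lemma taylorSeriesAtZero_mul {g h : ℂ → ℂ} (hg : AnalyticAt ℂ g 0) (hh : AnalyticAt ℂ h 0) :
    taylorSeriesAtZero (fun z => g z * h z) = taylorSeriesAtZero g * taylorSeriesAtZero h := by
  ext n
  rw [PowerSeries.coeff_mul, Finset.Nat.sum_antidiagonal_eq_sum_range_succ_mk,
    coeff_taylorSeriesAtZero, iteratedDeriv_fun_mul hg.contDiffAt hh.contDiffAt, Finset.sum_div]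
  refine Finset.sum_congr rfl fun i hi => ?_
  have hin : i ≤ n := Nat.lt_succ_iff.mp (Finset.mem_range.mp hi)
  rw [coeff_taylorSeriesAtZero, coeff_taylorSeriesAtZero, Nat.cast_choose ℂ hin]
  have := Nat.factorial_ne_zero n
  have := Nat.factorial_ne_zero i
  have := Nat.factorial_ne_zero (n - i)
  field_simp

lemma taylorSeriesAtZero_add {g h : ℂ → ℂ} (hg : AnalyticAt ℂ g 0) (hh : AnalyticAt ℂ h 0) :
    taylorSeriesAtZero (fun z => g z + h z) = taylorSeriesAtZero g + taylorSeriesAtZero h := by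
  ext n
  rw [map_add, coeff_taylorSeriesAtZero, coeff_taylorSeriesAtZero, coeff_taylorSeriesAtZero,
    iteratedDeriv_fun_add hg.contDiffAt hh.contDiffAt, add_div]

lemma taylorSeriesAtZero_const (k : ℂ) :
    taylorSeriesAtZero (fun _ => k) = PowerSeries.C k := by
  ext n
  rw [coeff_taylorSeriesAtZero, iteratedDeriv_const, PowerSeries.coeff_C]
  split_ifs with hn <;> simp [hn]

lemma taylorSeriesAtZero_id : taylorSeriesAtZero (fun z => z) = PowerSeries.X := by
  ext n
  have hpow := iteratedDeriv_fun_pow_zero (𝕜 := ℂ) (n := n) (m := 1)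
  simp only [pow_one] at hpow
  rw [coeff_taylorSeriesAtZero, hpow, PowerSeries.coeff_X]
  split_ifs with hn <;> simp [hn]

lemma taylorSeriesAtZero_deriv (g : ℂ → ℂ) :
    taylorSeriesAtZero (deriv g) = PowerSeries.derivative ℂ (taylorSeriesAtZero g) := by
  ext n
  rw [PowerSeries.coeff_derivative, coeff_taylorSeriesAtZero, coeff_taylorSeriesAtZero,
    iteratedDeriv_succ', Nat.factorial_succ]
  have := Nat.factorial_ne_zero n
  have : (n : ℂ) + 1 ≠ 0 := Nat.cast_add_one_ne_zero n
  push_cast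
  field_simp

/-- **Coefficient formulas over the Carathéodory class, `φ(z) = (1 + z/2)²`.**
Let `f` be analytic on the unit disk with expansion `f(z) = z + Σ_{n≥2} aₙ zⁿ`, let
`p` be analytic on the disk with `p(0) = 1`, `Re p > 0`, and expansion
`p(z) = 1 + Σ_{n≥1} pₙ zⁿ`, and suppose the Schwarz function `ω = (p − 1)/(p + 1)`
satisfies `z f''(z) = f'(z)(φ(ω(z)) − 1)` on the disk.  Then
`a₂ = p₁/4`, `a₃ = (p₁² + 8p₂)/96`, `a₄ = (−p₁³ + 32p₃)/768`, and
`a₅ = (11p₁⁴ − 48p₁²p₂ − 64p₁p₃ − 96p₂² + 768p₄)/30720`. -/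
theorem caratheodory_coefficient_formulas
    (f p : ℂ → ℂ) (a c : ℕ → ℂ)
    (hf : AnalyticOnNhd ℂ f (ball (0:ℂ) 1))
    (ha : ∀ z ∈ ball (0:ℂ) 1, HasSum (fun n => a n * z ^ n) (f z))
    (ha0 : a 0 = 0) (ha1 : a 1 = 1)
    (hp : AnalyticOnNhd ℂ p (ball (0:ℂ) 1))
    (hpre : ∀ z ∈ ball (0:ℂ) 1, 0 < (p z).re)
    (hc : ∀ z ∈ ball (0:ℂ) 1, HasSum (fun n => c n * z ^ n) (p z))
    (hc0 : c 0 = 1)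
    (hsub : ∀ z ∈ ball (0:ℂ) 1,
      z * deriv (deriv f) z
        = deriv f z * ((1 + ((p z - 1) / (p z + 1)) / 2) ^ 2 - 1)) :
    a 2 = c 1 / 4 ∧
    a 3 = (c 1 ^ 2 + 8 * c 2) / 96 ∧
    a 4 = (-(c 1) ^ 3 + 32 * c 3) / 768 ∧
    a 5 = (11 * c 1 ^ 4 - 48 * c 1 ^ 2 * c 2 - 64 * c 1 * c 3 - 96 * c 2 ^ 2
        + 768 * c 4) / 30720 := by
  have hball : ball (0:ℂ) 1 ∈ 𝓝 0 := ball_mem_nhds 0 one_pos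
  have hmem : (0:ℂ) ∈ ball (0:ℂ) 1 := mem_ball_self one_pos
  have hf1 : AnalyticAt ℂ (deriv f) 0 := (hf 0 hmem).deriv
  have hf2 : AnalyticAt ℂ (fun z => deriv (deriv f) z) 0 := hf1.deriv
  have hp0 := hp 0 hmem
  have hcleared : (fun z => z * deriv (deriv f) z * (4 * ((p z + 1) * (p z + 1)))) =ᶠ[𝓝 0]
      fun z => deriv f z * ((5 * p z + 3) * (p z + -1)) := by
    filter_upwards [hball] with z hz
    have hne : p z + 1 ≠ 0 := fun h => by
      have := congrArg Complex.re h
      simp only [Complex.add_re, Complex.one_re, Complex.zero_re] at this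
      linarith [hpre z hz]
    rw [hsub z hz]
    field_simp
    ring
  have hseries := taylorSeriesAtZero_congr hcleared
  rw [taylorSeriesAtZero_mul (g := fun z => z * deriv (deriv f) z)
      (analyticAt_id.fun_mul hf2) (by fun_prop),
    taylorSeriesAtZero_mul (g := fun z => z) analyticAt_id hf2] at hseries
  simp (discharger := fun_prop) only [taylorSeriesAtZero_mul, taylorSeriesAtZero_add,
    taylorSeriesAtZero_const, taylorSeriesAtZero_id, taylorSeriesAtZero_deriv,
    taylorSeriesAtZero_of_hasSum (Filter.mem_of_superset hball ha),
    taylorSeriesAtZero_of_hasSum (Filter.mem_of_superset hball hc)] at hseries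
  have hcoeff (n : ℕ) := congrArg (PowerSeries.coeff n) hseries
  have h1 := hcoeff 1
  have h2 := hcoeff 2
  have h3 := hcoeff 3
  have h4 := hcoeff 4
  simp [PowerSeries.coeff_mul, Finset.Nat.antidiagonal_succ, PowerSeries.coeff_derivative,
    PowerSeries.coeff_X, PowerSeries.coeff_C, PowerSeries.coeff_one, ha1, hc0] at h1 h2 h3 h4
  have e2 : a 2 = c 1 / 4 := by linear_combination h1 / 32
  have e3 : a 3 = (c 1 ^ 2 + 8 * c 2) / 96 := by
    rw [e2] at h2
    linear_combination h2 / 96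
  have e4 : a 4 = (-(c 1) ^ 3 + 32 * c 3) / 768 := by
    rw [e2, e3] at h3
    linear_combination h3 / 192
  refine ⟨e2, e3, e4, ?_⟩
  rw [e2, e3, e4] at h4
  linear_combination h4 / 320
end

section
/- With the hypotheses and notation of the Carathéodory coefficient formulas (f ∈ 𝒜, p ∈ 𝒫 with coefficients pₙ, and z f''(z) = f'(z)(φ((p(z)−1)/(p(z)+1)) − 1) on 𝔻), the second Hankel determinant satisfies 2304 (a₂a₄ − a₃²) = −p₁⁴ − 4p₁²p₂ − 16p₂² + 24p₁p₃. -/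
open Metric

open Filter Topology PowerSeries

/-- The formal power series `A` converges to `g` in a neighbourhood of the origin. -/
def HasPowerSeriesAtZero (g : ℂ → ℂ) (A : PowerSeries ℂ) : Prop :=
  ∀ᶠ z in 𝓝 (0 : ℂ), HasSum (fun n => coeff n A * z ^ n) (g z)

namespace HasPowerSeriesAtZero

variable {g h : ℂ → ℂ} {A B : PowerSeries ℂ}

theorem hasFPowerSeriesAt (hg : HasPowerSeriesAtZero g A) :
    HasFPowerSeriesAt g (FormalMultilinearSeries.ofScalars ℂ fun n => coeff n A) 0 := by
  rw [hasFPowerSeriesAt_iff]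
  filter_upwards [hg] with z hz
  simpa [FormalMultilinearSeries.coeff_ofScalars, mul_comm] using hz

theorem unique (hg : HasPowerSeriesAtZero g A) (hh : HasPowerSeriesAtZero h B)
    (hgh : g =ᶠ[𝓝 0] h) : A = B := by
  ext n
  have key := hg.hasFPowerSeriesAt.eq_formalMultilinearSeries
    (hh.hasFPowerSeriesAt.congr hgh.symm)
  simpa [FormalMultilinearSeries.coeff_ofScalars] using
    congrArg (fun s => FormalMultilinearSeries.coeff s n) key

theorem of_analyticAt (hg : AnalyticAt ℂ g 0) :
    HasPowerSeriesAtZero g (PowerSeries.mk fun n => iteratedDeriv n g 0 / n.factorial) := by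
  have key := hg.hasFPowerSeriesAt
  rw [hasFPowerSeriesAt_iff] at key
  filter_upwards [key] with z hz
  simpa [FormalMultilinearSeries.coeff_ofScalars, mul_comm] using hz

theorem deriv (hg : HasPowerSeriesAtZero g A) :
    HasPowerSeriesAtZero (deriv g) (derivative ℂ A) := by
  have hga : AnalyticAt ℂ g 0 := hg.hasFPowerSeriesAt.analyticAt
  have hA := hg.unique (of_analyticAt hga) EventuallyEq.rfl
  convert of_analyticAt hga.deriv using 1
  ext n
  rw [hA, coeff_derivative, coeff_mk, coeff_mk, iteratedDeriv_succ', Nat.factorial_succ]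
  have := Nat.factorial_ne_zero n
  have : (n : ℂ) + 1 ≠ 0 := Nat.cast_add_one_ne_zero n
  push_cast
  field_simp

theorem add (hg : HasPowerSeriesAtZero g A) (hh : HasPowerSeriesAtZero h B) :
    HasPowerSeriesAtZero (fun z => g z + h z) (A + B) := by
  filter_upwards [hg, hh] with z hz hz'
  simpa [add_mul] using hz.add hz'

theorem mul (hg : HasPowerSeriesAtZero g A) (hh : HasPowerSeriesAtZero h B) :
    HasPowerSeriesAtZero (fun z => g z * h z) (A * B) := by
  filter_upwards [hg, hh] with z hz hz'
  have hn := hz.summable.norm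
  have hn' := hz'.summable.norm
  have key := (summable_norm_sum_mul_antidiagonal_of_summable_norm hn hn').of_norm.hasSum
  rw [← tsum_mul_tsum_eq_tsum_sum_antidiagonal_of_summable_norm hn hn', hz.tsum_eq,
    hz'.tsum_eq] at key
  refine (congrArg (HasSum · (g z * h z)) (funext fun n => ?_)).mpr key
  rw [coeff_mul, Finset.sum_mul]
  refine Finset.sum_congr rfl fun kl hkl => ?_
  rw [← Finset.HasAntidiagonal.mem_antidiagonal.mp hkl, pow_add]
  ring

theorem const (w : ℂ) : HasPowerSeriesAtZero (fun _ => w) (C w) := by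
  refine Eventually.of_forall fun z => ?_
  convert hasSum_single (f := fun n => coeff n (C w) * z ^ n) 0 fun n hn => ?_ using 1
  · simp
  · simp [coeff_C, hn]

theorem id : HasPowerSeriesAtZero (fun z => z) X := by
  refine Eventually.of_forall fun z => ?_
  convert hasSum_single (f := fun n => coeff n (X : PowerSeries ℂ) * z ^ n) 1
    fun n hn => ?_ using 1
  · simp
  · simp [coeff_X, hn]

end HasPowerSeriesAtZero

/-- **Second Hankel determinant in Carathéodory coefficients, `φ(z) = (1 + z/2)²`.**
With `f` analytic on the unit disk, `f(z) = z + Σ_{n≥2} aₙ zⁿ`, `p` in the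
Carathéodory class with expansion `p(z) = 1 + Σ_{n≥1} pₙ zⁿ`, and
`z f''(z) = f'(z)(φ((p(z)−1)/(p(z)+1)) − 1)` on the disk, one has
`2304 (a₂a₄ − a₃²) = −p₁⁴ − 4p₁²p₂ − 16p₂² + 24p₁p₃`. -/
theorem second_hankel_caratheodory_identity
    (f p : ℂ → ℂ) (a c : ℕ → ℂ)
    (hf : AnalyticOnNhd ℂ f (ball (0:ℂ) 1))
    (ha : ∀ z ∈ ball (0:ℂ) 1, HasSum (fun n => a n * z ^ n) (f z))
    (ha0 : a 0 = 0) (ha1 : a 1 = 1)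
    (hp : AnalyticOnNhd ℂ p (ball (0:ℂ) 1))
    (hpre : ∀ z ∈ ball (0:ℂ) 1, 0 < (p z).re)
    (hc : ∀ z ∈ ball (0:ℂ) 1, HasSum (fun n => c n * z ^ n) (p z))
    (hc0 : c 0 = 1)
    (hsub : ∀ z ∈ ball (0:ℂ) 1,
      z * deriv (deriv f) z
        = deriv f z * ((1 + ((p z - 1) / (p z + 1)) / 2) ^ 2 - 1)) :
    2304 * (a 2 * a 4 - a 3 ^ 2)
      = -(c 1) ^ 4 - 4 * c 1 ^ 2 * c 2 - 16 * c 2 ^ 2 + 24 * c 1 * c 3 := by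
  have hball : ball (0 : ℂ) 1 ∈ 𝓝 (0 : ℂ) := ball_mem_nhds 0 one_pos
  have hF : HasPowerSeriesAtZero f (PowerSeries.mk a) := by
    filter_upwards [hball] with z hz
    simpa using ha z hz
  have hP : HasPowerSeriesAtZero p (PowerSeries.mk c) := by
    filter_upwards [hball] with z hz
    simpa using hc z hz
  have hP1 := hP.add (.const 1)
  have hlhs := (hP1.mul hP1).mul ((HasPowerSeriesAtZero.const 4).mul
    (HasPowerSeriesAtZero.id.mul hF.deriv.deriv))
  have hrhs := (hP.add (.const (-1))).mul
    ((((HasPowerSeriesAtZero.const 5).mul hP).add (.const 3)).mul hF.deriv)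
  have key := hlhs.unique hrhs <| by
    filter_upwards [hball] with z hz
    have hne : p z + 1 ≠ 0 := fun h0 => by
      have := congrArg Complex.re h0
      simp only [Complex.add_re, Complex.one_re, Complex.zero_re] at this
      linarith [hpre z hz]
    rw [hsub z hz]
    field_simp
    ring
  have h1 := congrArg (coeff 1) key
  have h2 := congrArg (coeff 2) key
  have h3 := congrArg (coeff 3) key
  simp [coeff_mul, Finset.Nat.antidiagonal_succ, coeff_derivative, coeff_C, coeff_X, ha1, hc0]
    at h1 h2 h3
  have ha2 : a 2 = c 1 / 4 := by linear_combination h1 / 32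
  rw [ha2] at h2 h3
  have ha3 : a 3 = c 2 / 12 + c 1 ^ 2 / 96 := by linear_combination h2 / 96
  rw [ha3] at h3
  have ha4 : a 4 = c 3 / 24 - c 1 ^ 3 / 768 := by linear_combination h3 / 192
  rw [ha2, ha3, ha4]
  ring
end

section
/- With the hypotheses and notation of the Schwarz-function coefficient formulas (f ∈ 𝒜, ω a Schwarz function with coefficients cₙ, and z f''(z) = f'(z)(φ(ω(z)) − 1) on 𝔻), the third Hankel determinant H₃(1) = a₃(a₂a₄ − a₃²) − a₄(a₄ − a₂a₃) + a₅(a₃ − a₂²) satisfies 69120 H₃(1) = −7c₁⁶ + 42c₁⁴c₂ + 96c₁³c₃ + 96c₁c₂c₃ − 12c₁²(17c₂² + 12c₄) + 16(7c₂³ − 30c₃² + 36c₂c₄). -/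
open Metric

/-- The `n`-th Taylor coefficient of a function at the origin. -/
noncomputable def taylorCoeffZero (g : ℂ → ℂ) (n : ℕ) : ℂ :=
  iteratedDeriv n g 0 / n.factorial

theorem taylorCoeffZero_congr {g h : ℂ → ℂ} (hgh : g =ᶠ[nhds 0] h) (n : ℕ) :
    taylorCoeffZero g n = taylorCoeffZero h n := by
  rw [taylorCoeffZero, taylorCoeffZero, hgh.iteratedDeriv_eq]

theorem taylorCoeffZero_eq_of_hasSum {g : ℂ → ℂ} {b : ℕ → ℂ} (hg : AnalyticAt ℂ g 0)
    (hb : ∀ z ∈ ball (0 : ℂ) 1, HasSum (fun n => b n * z ^ n) (g z)) (n : ℕ) :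
    taylorCoeffZero g n = b n := by
  have hser : HasFPowerSeriesAt g (FormalMultilinearSeries.ofScalars ℂ b) 0 := by
    rw [hasFPowerSeriesAt_iff]
    filter_upwards [ball_mem_nhds (0 : ℂ) one_pos] with z hz
    simpa [mul_comm] using hb z hz
  have heq := hg.hasFPowerSeriesAt.eq_formalMultilinearSeries hser
  simpa [taylorCoeffZero] using congrArg (fun p => p.coeff n) heq

theorem taylorCoeffZero_mul {g h : ℂ → ℂ} (hg : AnalyticAt ℂ g 0) (hh : AnalyticAt ℂ h 0)
    (n : ℕ) :
    taylorCoeffZero (g * h) n =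
      ∑ i ∈ Finset.range (n + 1), taylorCoeffZero g i * taylorCoeffZero h (n - i) := by
  rw [taylorCoeffZero, iteratedDeriv_mul hg.contDiffAt hh.contDiffAt, Finset.sum_div]
  refine Finset.sum_congr rfl fun i hi => ?_
  rw [Nat.cast_choose _ (Nat.lt_succ_iff.mp (Finset.mem_range.mp hi))]
  simp only [taylorCoeffZero]
  have := Nat.cast_ne_zero (R := ℂ).mpr n.factorial_ne_zero
  field_simp

theorem taylorCoeffZero_add {g h : ℂ → ℂ} (hg : AnalyticAt ℂ g 0) (hh : AnalyticAt ℂ h 0)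
    (n : ℕ) : taylorCoeffZero (g + h) n = taylorCoeffZero g n + taylorCoeffZero h n := by
  simp only [taylorCoeffZero, iteratedDeriv_add hg.contDiffAt hh.contDiffAt, add_div]

theorem taylorCoeffZero_deriv (g : ℂ → ℂ) (n : ℕ) :
    taylorCoeffZero (deriv g) n = (n + 1) * taylorCoeffZero g (n + 1) := by
  simp only [taylorCoeffZero, ← iteratedDeriv_succ', Nat.factorial_succ]
  have := Nat.cast_ne_zero (R := ℂ).mpr n.factorial_ne_zero
  have := Nat.cast_add_one_ne_zero (R := ℂ) n
  push_cast
  field_simp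

theorem taylorCoeffZero_id_mul_succ {g : ℂ → ℂ} (hg : AnalyticAt ℂ g 0) (n : ℕ) :
    taylorCoeffZero (id * g) (n + 1) = taylorCoeffZero g n := by
  rw [taylorCoeffZero_mul analyticAt_id hg, Finset.sum_eq_single 1]
  · simp [taylorCoeffZero]
  · intro i _ hi
    rcases i with _ | _ | i <;> simp_all [taylorCoeffZero, iteratedDeriv_id]
  · simp

/-- Comparing coefficients in `z f''(z) = f'(z) (ω(z) + ω(z)² / 4)`. -/
theorem taylorCoeffZero_recurrence {f ω : ℂ → ℂ} (hf : AnalyticAt ℂ f 0)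
    (hω : AnalyticAt ℂ ω 0)
    (hsub : ∀ᶠ z in nhds 0, z * deriv (deriv f) z = deriv f z * ((1 + ω z / 2) ^ 2 - 1))
    (n : ℕ) :
    (n + 1) * ((n + 2) * taylorCoeffZero f (n + 2)) =
      ∑ i ∈ Finset.range (n + 2), (i + 1) * taylorCoeffZero f (i + 1) *
        (taylorCoeffZero ω (n + 1 - i) +
          (∑ j ∈ Finset.range (n + 1 - i + 1),
            taylorCoeffZero ω j * taylorCoeffZero ω (n + 1 - i - j)) / 4) := by
  have hquad (m : ℕ) : taylorCoeffZero (fun z => (1 + ω z / 2) ^ 2 - 1) m =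
      taylorCoeffZero ω m +
        (∑ j ∈ Finset.range (m + 1), taylorCoeffZero ω j * taylorCoeffZero ω (m - j)) / 4 := by
    have hfun : (fun z => (1 + ω z / 2) ^ 2 - 1) = ω + fun z => (1 / 4 : ℂ) * (ω * ω) z := by
      funext z
      simp only [Pi.add_apply, Pi.mul_apply]
      ring
    rw [hfun, taylorCoeffZero_add hω (analyticAt_const.fun_mul (hω.mul hω)),
      ← taylorCoeffZero_mul hω hω]
    simp only [taylorCoeffZero, iteratedDeriv_const_mul_field]
    ring
  have hcongr := taylorCoeffZero_congr (g := id * deriv (deriv f))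
    (h := deriv f * fun z => (1 + ω z / 2) ^ 2 - 1)
    (by filter_upwards [hsub] with z hz using hz) (n + 1)
  rw [taylorCoeffZero_id_mul_succ hf.deriv.deriv,
    taylorCoeffZero_mul hf.deriv (by fun_prop), taylorCoeffZero_deriv,
    taylorCoeffZero_deriv] at hcongr
  simp only [taylorCoeffZero_deriv, hquad] at hcongr
  rw [← hcongr]
  push_cast
  ring

/-- **Third Hankel determinant in Schwarz-function coefficients, `φ(z) = (1 + z/2)²`.**
With `f` analytic on the unit disk, `f(z) = z + Σ_{n≥2} aₙ zⁿ`, `ω` a Schwarz function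
with expansion `ω(z) = Σ_{n≥1} cₙ zⁿ`, and `z f''(z) = f'(z)(φ(ω(z)) − 1)` on the disk,
the third Hankel determinant `H₃(1) = a₃(a₂a₄ − a₃²) − a₄(a₄ − a₂a₃) + a₅(a₃ − a₂²)`
satisfies
`69120 H₃(1) = −7c₁⁶ + 42c₁⁴c₂ + 96c₁³c₃ + 96c₁c₂c₃ − 12c₁²(17c₂² + 12c₄)
  + 16(7c₂³ − 30c₃² + 36c₂c₄)`. -/
theorem third_hankel_schwarz_identity
    (f ω : ℂ → ℂ) (a c : ℕ → ℂ)
    (hf : AnalyticOnNhd ℂ f (ball (0:ℂ) 1))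
    (ha : ∀ z ∈ ball (0:ℂ) 1, HasSum (fun n => a n * z ^ n) (f z))
    (ha0 : a 0 = 0) (ha1 : a 1 = 1)
    (hω : AnalyticOnNhd ℂ ω (ball (0:ℂ) 1))
    (hω0 : ω 0 = 0)
    (hω1 : ∀ z ∈ ball (0:ℂ) 1, ‖ω z‖ < 1)
    (hc : ∀ z ∈ ball (0:ℂ) 1, HasSum (fun n => c n * z ^ n) (ω z))
    (hc0 : c 0 = 0)
    (hsub : ∀ z ∈ ball (0:ℂ) 1,
      z * deriv (deriv f) z = deriv f z * ((1 + ω z / 2) ^ 2 - 1)) :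
    69120 * (a 3 * (a 2 * a 4 - a 3 ^ 2) - a 4 * (a 4 - a 2 * a 3)
        + a 5 * (a 3 - a 2 ^ 2))
      = -7 * c 1 ^ 6 + 42 * c 1 ^ 4 * c 2 + 96 * c 1 ^ 3 * c 3 + 96 * c 1 * c 2 * c 3
        - 12 * c 1 ^ 2 * (17 * c 2 ^ 2 + 12 * c 4)
        + 16 * (7 * c 2 ^ 3 - 30 * c 3 ^ 2 + 36 * c 2 * c 4) := by
  have hmem : (0 : ℂ) ∈ ball (0 : ℂ) 1 := mem_ball_self one_pos
  have hrec := taylorCoeffZero_recurrence (hf 0 hmem) (hω 0 hmem)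
    (Filter.eventually_of_mem (ball_mem_nhds 0 one_pos) hsub)
  simp only [taylorCoeffZero_eq_of_hasSum (hf 0 hmem) ha,
    taylorCoeffZero_eq_of_hasSum (hω 0 hmem) hc] at hrec
  have hrec₀ := hrec 0
  have hrec₁ := hrec 1
  have hrec₂ := hrec 2
  have hrec₃ := hrec 3
  simp [Finset.sum_range_succ, ha1, hc0] at hrec₀ hrec₁ hrec₂ hrec₃
  have h₂ : a 2 = c 1 / 2 := by linear_combination hrec₀ / 2
  rw [h₂] at hrec₁ hrec₂ hrec₃
  have h₃ : a 3 = (c 2 + 5 / 4 * c 1 ^ 2) / 6 := by linear_combination hrec₁ / 6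
  rw [h₃] at hrec₂ hrec₃
  have h₄ : a 4 = (c 3 + 2 * c 1 * c 2 + 7 / 8 * c 1 ^ 3) / 12 := by
    linear_combination hrec₂ / 12
  rw [h₄] at hrec₃
  have h₅ : a 5 = (c 4 + c 1 * c 3 / 2 + c 2 ^ 2 / 4 + (c 3 + c 1 * c 2 / 2) * c 1
      + (c 2 + c 1 ^ 2 / 4) * (c 2 + 5 / 4 * c 1 ^ 2) / 2
      + c 1 * (c 3 + 2 * c 1 * c 2 + 7 / 8 * c 1 ^ 3) / 3) / 20 := by
    linear_combination hrec₃ / 20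
  rw [h₂, h₃, h₄, h₅]
  ring
end

section
/- Polynomial inequality for the case y = 1: for all real p ∈ [0,1] and x ∈ [0,1], G₁(p,x) ≤ 480, with equality if and only if (p,x) = (0,0), where G₁(p,x) := 7p⁶ + 42p⁴(1−p²)x + 12p²(17−26p²+9p⁴)x² + 16(7(1−p²) + 20p²(1−p²) + 4p⁴(1−p²))x³ + 96p²(1−p²)²x⁴ + 96p(1−p²)(1−x²)(p² + x + 2p²x + 2(1−p²)x²) + 48(1−p²)(1−x²)(3x(p² + 4(1−p²)x) + 10(1−p²)(1−x²)). -/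
/-- The polynomial `G₁(p,x)`, the `y = 1` case of the upper-bound function for the
third Hankel determinant over the class `C((1+z/2)²)`. -/
def G₁ (p x : ℝ) : ℝ :=
  7 * p ^ 6 + 42 * p ^ 4 * (1 - p ^ 2) * x
    + 12 * p ^ 2 * (17 - 26 * p ^ 2 + 9 * p ^ 4) * x ^ 2
    + 16 * (7 * (1 - p ^ 2) + 20 * p ^ 2 * (1 - p ^ 2) + 4 * p ^ 4 * (1 - p ^ 2)) * x ^ 3
    + 96 * p ^ 2 * (1 - p ^ 2) ^ 2 * x ^ 4
    + 96 * p * (1 - p ^ 2) * (1 - x ^ 2)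
        * (p ^ 2 + x + 2 * p ^ 2 * x + 2 * (1 - p ^ 2) * x ^ 2)
    + 48 * (1 - p ^ 2) * (1 - x ^ 2)
        * (3 * x * (p ^ 2 + 4 * (1 - p ^ 2) * x) + 10 * (1 - p ^ 2) * (1 - x ^ 2))

/-- A quadratic gap for `G₁` on the unit square, obtained by expanding
`480 - G₁ p x - 48 * (p - x) ^ 2 - 20 * (p ^ 2 + x ^ 2)` in the Bernstein basis of bidegree
`(6, 4)`, where all its coefficients are nonnegative. -/
theorem G₁_add_sq_le {p x : ℝ} (hp : p ∈ Set.Icc (0 : ℝ) 1) (hx : x ∈ Set.Icc (0 : ℝ) 1) :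
    G₁ p x + 20 * (p ^ 2 + x ^ 2) ≤ 480 := by
  obtain ⟨hp0, hp1⟩ := hp
  obtain ⟨hx0, hx1⟩ := hx
  have hq : 0 ≤ 1 - p := sub_nonneg.2 hp1
  have hy : 0 ≤ 1 - x := sub_nonneg.2 hx1
  have bernstein : 480 - G₁ p x - 48 * (p - x) ^ 2 - 20 * (p ^ 2 + x ^ 2) =
        (1 - p) ^ 6
            * (316 * x ^ 2 * (1 - x) ^ 2
              + 520 * x ^ 3 * (1 - x)
              + 300 * x ^ 4)
          + p * (1 - p) ^ 5
            * (1704 * x ^ 2 * (1 - x) ^ 2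
              + 2832 * x ^ 3 * (1 - x)
              + 1896 * x ^ 4)
          + p ^ 2 * (1 - p) ^ 4
            * (892 * (1 - x) ^ 4
              + 3424 * x * (1 - x) ^ 3
              + 7728 * x ^ 2 * (1 - x) ^ 2
              + 7488 * x ^ 3 * (1 - x)
              + 4404 * x ^ 4)
          + p ^ 3 * (1 - p) ^ 3
            * (3472 * (1 - x) ^ 4
              + 13216 * x * (1 - x) ^ 3
              + 19808 * x ^ 2 * (1 - x) ^ 2
              + 12416 * x ^ 3 * (1 - x)
              + 4656 * x ^ 4)
          + p ^ 4 * (1 - p) ^ 2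
            * (4584 * (1 - x) ^ 4
              + 17286 * x * (1 - x) ^ 3
              + 23478 * x ^ 2 * (1 - x) ^ 2
              + 12730 * x ^ 3 * (1 - x)
              + 2722 * x ^ 4)
          + p ^ 5 * (1 - p)
            * (2416 * (1 - x) ^ 4
              + 9196 * x * (1 - x) ^ 3
              + 12684 * x ^ 2 * (1 - x) ^ 2
              + 7316 * x ^ 3 * (1 - x)
              + 1412 * x ^ 4)
          + p ^ 6
            * (405 * (1 - x) ^ 4
              + 1716 * x * (1 - x) ^ 3
              + 2650 * x ^ 2 * (1 - x) ^ 2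
              + 1772 * x ^ 3 * (1 - x)
              + 433 * x ^ 4) := by
    unfold G₁
    ring
  have bernstein_nonneg : 0 ≤ 480 - G₁ p x - 48 * (p - x) ^ 2 - 20 * (p ^ 2 + x ^ 2) := by
    rw [bernstein]
    positivity
  linarith [sq_nonneg (p - x)]

/-- **Polynomial inequality for the case `y = 1`:** for all `p, x ∈ [0,1]`,
`G₁(p,x) ≤ 480`, with equality if and only if `(p,x) = (0,0)`. -/
theorem G1_le_480 (p x : ℝ) (hp : p ∈ Set.Icc (0:ℝ) 1) (hx : x ∈ Set.Icc (0:ℝ) 1) :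
    G₁ p x ≤ 480 ∧ (G₁ p x = 480 ↔ p = 0 ∧ x = 0) := by
  have gap := G₁_add_sq_le hp hx
  refine ⟨by linarith [sq_nonneg p, sq_nonneg x], fun h => ?_, ?_⟩
  · have hp2 : p ^ 2 = 0 := by linarith [sq_nonneg p, sq_nonneg x]
    have hx2 : x ^ 2 = 0 := by linarith [sq_nonneg p, sq_nonneg x]
    exact ⟨pow_eq_zero_iff two_ne_zero |>.1 hp2, pow_eq_zero_iff two_ne_zero |>.1 hx2⟩
  · rintro ⟨rfl, rfl⟩
    norm_num [G₁]
end

section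
/- Polynomial inequality for the case y = 0: for all real p ∈ [0,1] and x ∈ [0,1], G₂(p,x) ≤ 1022/3, where G₂(p,x) := 7p⁶ + 42p⁴(1−p²)x + 12p²(17−26p²+9p⁴)x² + 16(7(1−p²) + 20p²(1−p²) + 4p⁴(1−p²))x³ + 96p²(1−p²)²x⁴ + 96p(1−p²)(1−x²)(p² + x + 2p²x + 2(1−p²)x²) + 144(1−p²)(p² + 4(1−p²)x)(1−x²). In particular G₂(p,x) ≤ 480 on [0,1]². -/
/-- The polynomial `G₂(p,x)`, the `y = 0` case of the upper-bound function for the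
third Hankel determinant over the class `C((1+z/2)²)`. -/
def G₂ (p x : ℝ) : ℝ :=
  7 * p ^ 6 + 42 * p ^ 4 * (1 - p ^ 2) * x
    + 12 * p ^ 2 * (17 - 26 * p ^ 2 + 9 * p ^ 4) * x ^ 2
    + 16 * (7 * (1 - p ^ 2) + 20 * p ^ 2 * (1 - p ^ 2) + 4 * p ^ 4 * (1 - p ^ 2)) * x ^ 3
    + 96 * p ^ 2 * (1 - p ^ 2) ^ 2 * x ^ 4
    + 96 * p * (1 - p ^ 2) * (1 - x ^ 2)
        * (p ^ 2 + x + 2 * p ^ 2 * x + 2 * (1 - p ^ 2) * x ^ 2)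
    + 144 * (1 - p ^ 2) * (p ^ 2 + 4 * (1 - p ^ 2) * x) * (1 - x ^ 2)

/-- A polynomial majorant of `G₂`, in terms of `q = p ^ 2`, is at most `1022 / 3` on the unit
square: the difference has nonnegative coefficients in the Bernstein basis of bidegree `(3, 4)`. -/
theorem G₂_majorant_le (q x : ℝ) (hq₀ : 0 ≤ q) (hq₁ : q ≤ 1) (hx₀ : 0 ≤ x) (hx₁ : x ≤ 1) :
    7 * q ^ 3 + 42 * q ^ 2 * (1 - q) * x
      + 12 * q * (17 - 26 * q + 9 * q ^ 2) * x ^ 2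
      + 16 * (7 * (1 - q) + 20 * q * (1 - q) + 4 * q ^ 2 * (1 - q)) * x ^ 3
      + 96 * q * (1 - q) ^ 2 * x ^ 4
      + 96 * (1 / 8 + 2 * q) * (1 - q) * (1 - x ^ 2)
          * (q + x + 2 * q * x + 2 * (1 - q) * x ^ 2)
      + 144 * (1 - q) * (q + 4 * (1 - q) * x) * (1 - x ^ 2) ≤ 1022 / 3 := by
  have bernstein_nonneg (u y : ℝ) (hu : 0 ≤ u) (hy : 0 ≤ y) : 0 ≤
      (1022 / 3 * y ^ 4 + 2324 / 3 * x * y ^ 3 + 256 * x ^ 2 * y ^ 2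
          + 80 / 3 * x ^ 3 * y + 686 / 3 * x ^ 4) * u ^ 3
      + (866 * y ^ 4 + 2648 * x * y ^ 3 + 2292 * x ^ 2 * y ^ 2
          + 376 * x ^ 3 * y + 178 * x ^ 4) * q * u ^ 2
      + (674 * y ^ 4 + 2042 * x * y ^ 3 + 2334 * x ^ 2 * y ^ 2
          + 1354 * x ^ 3 * y + 388 * x ^ 4) * q ^ 2 * u
      + (1001 / 3 * y ^ 4 + 4004 / 3 * x * y ^ 3 + 2002 * x ^ 2 * y ^ 2
          + 4004 / 3 * x ^ 3 * y + 1001 / 3 * x ^ 4) * q ^ 3 := by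
    positivity
  linarith [bernstein_nonneg (1 - q) (1 - x) (sub_nonneg.2 hq₁) (sub_nonneg.2 hx₁)]

/-- **Polynomial inequality for the case `y = 0`:** for all `p, x ∈ [0,1]`,
`G₂(p,x) ≤ 1022/3`; in particular `G₂(p,x) ≤ 480`. -/
theorem G2_le (p x : ℝ) (hp : p ∈ Set.Icc (0:ℝ) 1) (hx : x ∈ Set.Icc (0:ℝ) 1) :
    G₂ p x ≤ 1022 / 3 ∧ G₂ p x ≤ 480 := by
  obtain ⟨hp₀, hp₁⟩ := hp
  obtain ⟨hx₀, hx₁⟩ := hx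
  have hq₁ : p ^ 2 ≤ 1 := pow_le_one₀ hp₀ hp₁
  have hu : 0 ≤ 1 - p ^ 2 := sub_nonneg.2 hq₁
  have hw : 0 ≤ 1 - x ^ 2 := sub_nonneg.2 (pow_le_one₀ hx₀ hx₁)
  have hp : p ≤ 1 / 8 + 2 * p ^ 2 := by nlinarith [sq_nonneg (p - 1 / 4)]
  have hmixed : 96 * p * (1 - p ^ 2) * (1 - x ^ 2)
        * (p ^ 2 + x + 2 * p ^ 2 * x + 2 * (1 - p ^ 2) * x ^ 2)
      ≤ 96 * (1 / 8 + 2 * p ^ 2) * (1 - p ^ 2) * (1 - x ^ 2)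
        * (p ^ 2 + x + 2 * p ^ 2 * x + 2 * (1 - p ^ 2) * x ^ 2) := by
    gcongr
  have hmain : G₂ p x ≤ 1022 / 3 := by
    have := G₂_majorant_le (p ^ 2) x (sq_nonneg p) hq₁ hx₀ hx₁
    unfold G₂
    linarith
  exact ⟨hmain, by linarith⟩
end

section
/- Local lower bound near the origin: for all real p ∈ [0, 1/4] and x ∈ [0, 1/4], 480 − G₁(p,x) ≥ (144779/2048)(p² + x²), where G₁(p,x) := 7p⁶ + 42p⁴(1−p²)x + 12p²(17−26p²+9p⁴)x² + 16(7(1−p²) + 20p²(1−p²) + 4p⁴(1−p²))x³ + 96p²(1−p²)²x⁴ + 96p(1−p²)(1−x²)(p² + x + 2p²x + 2(1−p²)x²) + 48(1−p²)(1−x²)(3x(p² + 4(1−p²)x) + 10(1−p²)(1−x²)). -/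
/-- A monomial divisible by `p ^ 2` is at most a small multiple of `p ^ 2` when `p, x ∈ [0, 1/4]`. -/
theorem pow_mul_pow_le_sq_mul {p x : ℝ} (hp : p ∈ Set.Icc (0:ℝ) (1/4))
    (hx : x ∈ Set.Icc (0:ℝ) (1/4)) (a b : ℕ) :
    p ^ (a + 2) * x ^ b ≤ p ^ 2 * (1 / 4) ^ (a + b) := by
  obtain ⟨hp0, hp1⟩ := hp
  obtain ⟨hx0, hx1⟩ := hx
  calc p ^ (a + 2) * x ^ b = p ^ 2 * (p ^ a * x ^ b) := by ring
    _ ≤ p ^ 2 * ((1 / 4) ^ a * (1 / 4) ^ b) := by gcongr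
    _ = p ^ 2 * (1 / 4) ^ (a + b) := by ring

/-- **Local lower bound near the origin:** for all `p, x ∈ [0, 1/4]`,
`480 − G₁(p,x) ≥ (144779/2048)(p² + x²)`. -/
theorem local_lower_bound (p x : ℝ)
    (hp : p ∈ Set.Icc (0:ℝ) (1/4)) (hx : x ∈ Set.Icc (0:ℝ) (1/4)) :
    480 - G₁ p x ≥ (144779 / 2048) * (p ^ 2 + x ^ 2) := by
  have bound := pow_mul_pow_le_sq_mul hp hx
  have bound_swap := pow_mul_pow_le_sq_mul hx hp
  have monomial_nonneg (a b : ℕ) : 0 ≤ p ^ a * x ^ b :=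
    mul_nonneg (pow_nonneg hp.1 a) (pow_nonneg hx.1 b)
  unfold G₁
  linarith [sq_nonneg (p - x), sq_nonneg p, sq_nonneg x,
    bound_swap 1 0, bound_swap 0 1, bound 0 1, bound 1 0, bound 0 2, bound 1 1, bound 2 0,
    bound 0 3, bound 0 4, bound 4 0, bound 1 4, bound 3 2, bound 3 3, bound 4 2, bound 4 4,
    monomial_nonneg 0 4, monomial_nonneg 1 3, monomial_nonneg 1 4, monomial_nonneg 3 2,
    monomial_nonneg 4 1, monomial_nonneg 5 0, monomial_nonneg 3 3, monomial_nonneg 4 2,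
    monomial_nonneg 5 1, monomial_nonneg 4 3, monomial_nonneg 6 1, monomial_nonneg 4 4,
    monomial_nonneg 5 4, monomial_nonneg 6 3]
end
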